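/- Let 𝖠 = A_sym, suppose |σ'|≤1, |σ''|≤1, 0 < c₂ ≤ 1, max{w, ω/w + c₁γ + c₂} ≤ 1, and assume each message function ψ^{(t)} is linear (so its Hessian bound c^{(2)} can be taken to be 0). Let v≠u, r := d_G(v,u), and |1−c₂λ*| := max_{1≤ℓ≤n−1}|1−c₂λ_ℓ| < 1. If there exist an input X and coordinates 1≤α,β≤d with |∂²y^{(m)}(X)/∂x_v^α∂x_u^β| ≥ M > 0, then the depth m satisfies m ≥ τ(v,u)/(4c₂) + (|E|/√(d_v d_u))·( M/γ − (γ + |1−c₂λ*|^{r−1})/(c₂λ₁) ). -/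

import Mathlib

open scoped BigOperators

noncomputable section

namespace OSQ

variable {n d : ℕ}

/-- componentwise application of the activation function. -/
def act (σ : ℝ → ℝ) (x : EuclideanSpace ℝ (Fin d)) : EuclideanSpace ℝ (Fin d) :=
  WithLp.toLp 2 (fun i => σ (x i))

/-- node features computed by the MPNN after `t` layers. -/
def mpnn (σ : ℝ → ℝ) (𝒜 : Matrix (Fin n) (Fin n) ℝ)
    (Ω W : ℕ → EuclideanSpace ℝ (Fin d) →L[ℝ] EuclideanSpace ℝ (Fin d))
    (ψ : ℕ → EuclideanSpace ℝ (Fin d) × EuclideanSpace ℝ (Fin d) → EuclideanSpace ℝ (Fin d)) :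
    ℕ → (Fin n → EuclideanSpace ℝ (Fin d)) → Fin n → EuclideanSpace ℝ (Fin d)
  | 0, X, v => X v
  | (t+1), X, v =>
    act σ (Ω (t+1) (mpnn σ 𝒜 Ω W ψ t X v)
      + W (t+1) (∑ u : Fin n, 𝒜 v u • ψ (t+1) (mpnn σ 𝒜 Ω W ψ t X v, mpnn σ 𝒜 Ω W ψ t X u)))

/-- coordinate direction in the input space: a perturbation of entry `β` of the
feature of node `u`. -/
def dir (u : Fin n) (β : Fin d) : Fin n → EuclideanSpace ℝ (Fin d) :=
  Pi.single u (EuclideanSpace.single β 1)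

/-- `∂ h_v^{(m),α} / ∂ x_u^β`. -/
def jacEntry (σ : ℝ → ℝ) (𝒜 : Matrix (Fin n) (Fin n) ℝ)
    (Ω W : ℕ → EuclideanSpace ℝ (Fin d) →L[ℝ] EuclideanSpace ℝ (Fin d))
    (ψ : ℕ → EuclideanSpace ℝ (Fin d) × EuclideanSpace ℝ (Fin d) → EuclideanSpace ℝ (Fin d))
    (m : ℕ) (v u : Fin n) (X : Fin n → EuclideanSpace ℝ (Fin d)) (α β : Fin d) : ℝ :=
  fderiv ℝ (fun Y => mpnn σ 𝒜 Ω W ψ m Y v α) X (dir u β)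

/-- `∂² h_i^{(m),α} / ∂ x_v^β ∂ x_u^γ`. -/
def hessEntry (σ : ℝ → ℝ) (𝒜 : Matrix (Fin n) (Fin n) ℝ)
    (Ω W : ℕ → EuclideanSpace ℝ (Fin d) →L[ℝ] EuclideanSpace ℝ (Fin d))
    (ψ : ℕ → EuclideanSpace ℝ (Fin d) × EuclideanSpace ℝ (Fin d) → EuclideanSpace ℝ (Fin d))
    (m : ℕ) (i v u : Fin n) (X : Fin n → EuclideanSpace ℝ (Fin d)) (α β γ : Fin d) : ℝ :=
  fderiv ℝ (fun Y => fderiv ℝ (fun Z => mpnn σ 𝒜 Ω W ψ m Z i α) Y (dir u γ)) X (dir v β)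

/-- graph-level prediction with SUM readout: `y(X) = θᵀ Σ_v h_v^{(m)}`. -/
def readout (θ : EuclideanSpace ℝ (Fin d)) (σ : ℝ → ℝ) (𝒜 : Matrix (Fin n) (Fin n) ℝ)
    (Ω W : ℕ → EuclideanSpace ℝ (Fin d) →L[ℝ] EuclideanSpace ℝ (Fin d))
    (ψ : ℕ → EuclideanSpace ℝ (Fin d) × EuclideanSpace ℝ (Fin d) → EuclideanSpace ℝ (Fin d))
    (m : ℕ) (X : Fin n → EuclideanSpace ℝ (Fin d)) : ℝ :=
  ∑ α : Fin d, θ α * (∑ v : Fin n, mpnn σ 𝒜 Ω W ψ m X v) α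

/-- `∂² y^{(m)} / ∂ x_v^α ∂ x_u^β`. -/
def mixEntry (θ : EuclideanSpace ℝ (Fin d)) (σ : ℝ → ℝ) (𝒜 : Matrix (Fin n) (Fin n) ℝ)
    (Ω W : ℕ → EuclideanSpace ℝ (Fin d) →L[ℝ] EuclideanSpace ℝ (Fin d))
    (ψ : ℕ → EuclideanSpace ℝ (Fin d) × EuclideanSpace ℝ (Fin d) → EuclideanSpace ℝ (Fin d))
    (m : ℕ) (v u : Fin n) (X : Fin n → EuclideanSpace ℝ (Fin d)) (α β : Fin d) : ℝ :=
  fderiv ℝ (fun Y => fderiv ℝ (fun Z => readout θ σ 𝒜 Ω W ψ m Z) Y (dir u β)) X (dir v α)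

/-- the matrix `S := (ω/w)I + c₁ diag(𝒜 1) + c₂ 𝒜`. -/
def Smat (ω w c₁ c₂ : ℝ) (𝒜 : Matrix (Fin n) (Fin n) ℝ) : Matrix (Fin n) (Fin n) ℝ :=
  (ω / w) • (1 : Matrix (Fin n) (Fin n) ℝ)
    + c₁ • Matrix.diagonal (fun i => ∑ j, 𝒜 i j) + c₂ • 𝒜

/-- `diag(𝒜 1)` : the diagonal matrix of row sums. -/
def rowSumDiag (𝒜 : Matrix (Fin n) (Fin n) ℝ) : Matrix (Fin n) (Fin n) ℝ :=
  Matrix.diagonal (fun i => ∑ j, 𝒜 i j)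

/-- `diag(1ᵀ M)` : the diagonal matrix of column sums. -/
def colSumDiag (M : Matrix (Fin n) (Fin n) ℝ) : Matrix (Fin n) (Fin n) ℝ :=
  Matrix.diagonal (fun j => ∑ i, M i j)

/-- the operator (spectral) norm of a matrix, viewed as a linear map between
Euclidean spaces. -/
def matOpNorm {ι κ : Type*} [Fintype ι] [Fintype κ] [DecidableEq ι] (M : Matrix κ ι ℝ) : ℝ :=
  ‖LinearMap.toContinuousLinearMap (Matrix.toEuclideanLin M)‖


/-- the symmetrically-normalized adjacency matrix `A_sym := D^{-1/2} A D^{-1/2}`. -/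
def Asym (G : SimpleGraph (Fin n)) [DecidableRel G.Adj] : Matrix (Fin n) (Fin n) ℝ :=
  Matrix.diagonal (fun a => (Real.sqrt (G.degree a))⁻¹) * G.adjMatrix ℝ *
    Matrix.diagonal (fun a => (Real.sqrt (G.degree a))⁻¹)

/-- the random-walk normalized adjacency matrix `D^{-1} A`. -/
def Arw (G : SimpleGraph (Fin n)) [DecidableRel G.Adj] : Matrix (Fin n) (Fin n) ℝ :=
  Matrix.diagonal (fun a => ((G.degree a : ℝ))⁻¹) * G.adjMatrix ℝ
/-- the normalized graph Laplacian `Δ := I - A_sym`. -/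
def nLap (G : SimpleGraph (Fin n)) [DecidableRel G.Adj] : Matrix (Fin n) (Fin n) ℝ :=
  1 - Asym G

/-- the matrix `Z := I - c₂ Δ`. -/
def Zmat (c₂ : ℝ) (G : SimpleGraph (Fin n)) [DecidableRel G.Adj] : Matrix (Fin n) (Fin n) ℝ :=
  1 - c₂ • nLap G

/-- the commute time `τ(v,u) = 2|E| Σ_{ℓ≥1} (1/λ_ℓ)(φ_ℓ(v)/√d_v - φ_ℓ(u)/√d_u)²`,
expressed spectrally. -/
def commuteTime (G : SimpleGraph (Fin n)) [DecidableRel G.Adj]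
    (lam : Fin n → ℝ) (φ : Fin n → Fin n → ℝ) (v u : Fin n) : ℝ :=
  2 * (G.edgeFinset.card : ℝ) *
    ∑ ℓ ∈ Finset.univ.filter (fun ℓ : Fin n => (ℓ : ℕ) ≠ 0),
      (1 / lam ℓ) *
        (φ ℓ v / Real.sqrt (G.degree v) - φ ℓ u / Real.sqrt (G.degree u)) ^ 2

/-- the pseudo-inverse `Δ† := Σ_{ℓ≥1} (1/λ_ℓ) φ_ℓ φ_ℓᵀ` of the normalized Laplacian. -/
def nLapPinv (lam : Fin n → ℝ) (φ : Fin n → Fin n → ℝ) : Matrix (Fin n) (Fin n) ℝ :=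
  Matrix.of fun a b =>
    ∑ ℓ ∈ Finset.univ.filter (fun ℓ : Fin n => (ℓ : ℕ) ≠ 0), (1 / lam ℓ) * (φ ℓ a * φ ℓ b)

section Calculus

variable {E F F' : Type*} [NormedAddCommGroup E] [NormedSpace ℝ E]
  [NormedAddCommGroup F] [NormedSpace ℝ F] [NormedAddCommGroup F'] [NormedSpace ℝ F']

/-- iterated directional derivative. -/
def DD (p q : E) (f : E → F) (X : E) : F :=
  fderiv ℝ (fun Y => fderiv ℝ f Y q) X p

theorem diff_dir {f : E → F} (hf : ContDiff ℝ 2 f) (q : E) :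
    Differentiable ℝ (fun Y => fderiv ℝ f Y q) := by
  have h : ContDiff ℝ 1 (fderiv ℝ f) := hf.fderiv_right (by norm_num)
  exact (h.clm_apply contDiff_const).differentiable (by norm_num)

theorem fderiv_sum_clm {ι : Type*} [Fintype ι] (T : ι → F →L[ℝ] F') (f : ι → E → F)
    (hf : ∀ j, Differentiable ℝ (f j)) (X p : E) :
    fderiv ℝ (fun Y => ∑ j, T j (f j Y)) X p = ∑ j, T j (fderiv ℝ (f j) X p) := by
  have h : HasFDerivAt (fun Y => ∑ j, T j (f j Y))
      (∑ j, (T j).comp (fderiv ℝ (f j) X)) X := by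
    apply HasFDerivAt.fun_sum
    intro j _
    exact (T j).hasFDerivAt.comp X (hf j X).hasFDerivAt
  rw [h.fderiv]
  simp

theorem DD_sum_clm {ι : Type*} [Fintype ι] (T : ι → F →L[ℝ] F') (f : ι → E → F)
    (hf : ∀ j, ContDiff ℝ 2 (f j)) (X p q : E) :
    DD p q (fun Y => ∑ j, T j (f j Y)) X = ∑ j, T j (DD p q (f j) X) := by
  unfold DD
  have h : (fun Y => fderiv ℝ (fun Z => ∑ j, T j (f j Z)) Y q)
      = fun Y => ∑ j, T j (fderiv ℝ (f j) Y q) := by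
    funext Y
    exact fderiv_sum_clm T f (fun j => (hf j).differentiable (by norm_num)) Y q
  rw [h, fderiv_sum_clm T (fun j Y => fderiv ℝ (f j) Y q) (fun j => diff_dir (hf j) q)]

theorem fderiv_coord {f : E → EuclideanSpace ℝ (Fin d)} (hf : Differentiable ℝ f)
    (X p : E) (i : Fin d) :
    fderiv ℝ (fun Y => f Y i) X p = (fderiv ℝ f X p) i := by
  let pr : EuclideanSpace ℝ (Fin d) →L[ℝ] ℝ := EuclideanSpace.proj i
  have h2 : HasFDerivAt (fun Y => f Y i) (pr.comp (fderiv ℝ f X)) X :=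
    (pr.hasFDerivAt (x := f X)).comp X (hf X).hasFDerivAt
  rw [h2.fderiv]
  rfl

theorem DD_coord {f : E → EuclideanSpace ℝ (Fin d)} (hf : ContDiff ℝ 2 f)
    (X p q : E) (i : Fin d) :
    DD p q (fun Y => f Y i) X = (DD p q f X) i := by
  unfold DD
  have h : (fun Y => fderiv ℝ (fun Z => f Z i) Y q) = fun Y => (fderiv ℝ f Y q) i := by
    funext Y
    exact fderiv_coord (hf.differentiable (by norm_num)) Y q i
  rw [h, fderiv_coord (diff_dir hf q)]

theorem act_contDiff {σ : ℝ → ℝ} (hσ : ContDiff ℝ 2 σ)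
    {f : E → EuclideanSpace ℝ (Fin d)} (hf : ContDiff ℝ 2 f) :
    ContDiff ℝ 2 (fun Y => act σ (f Y)) := by
  rw [contDiff_euclidean]
  intro i
  rw [contDiff_euclidean] at hf
  exact hσ.comp (hf i)

theorem scalar_fderiv {σ : ℝ → ℝ} (hσ : ContDiff ℝ 2 σ) {g : E → ℝ} (hg : Differentiable ℝ g)
    (X p : E) :
    fderiv ℝ (fun Y => σ (g Y)) X p = deriv σ (g X) * fderiv ℝ g X p := by
  have h : HasFDerivAt (fun Y => σ (g Y)) (deriv σ (g X) • fderiv ℝ g X) X :=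
    ((hσ.differentiable (by norm_num)) (g X)).hasDerivAt.comp_hasFDerivAt X (hg X).hasFDerivAt
  rw [h.fderiv]
  simp

theorem scalar_DD {σ : ℝ → ℝ} (hσ : ContDiff ℝ 2 σ) {g : E → ℝ} (hg : ContDiff ℝ 2 g)
    (X p q : E) :
    DD p q (fun Y => σ (g Y)) X =
      deriv (deriv σ) (g X) * fderiv ℝ g X p * fderiv ℝ g X q
        + deriv σ (g X) * DD p q g X := by
  unfold DD
  have hgd : Differentiable ℝ g := hg.differentiable (by norm_num)
  have h : (fun Y => fderiv ℝ (fun Z => σ (g Z)) Y q)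
      = fun Y => deriv σ (g Y) * fderiv ℝ g Y q := by
    funext Y
    exact scalar_fderiv hσ hgd Y q
  have hσ1 : Differentiable ℝ (deriv σ) := by
    have : ContDiff ℝ 1 (deriv σ) := by
      have := (contDiff_succ_iff_deriv (n := 1) (f := σ)).1 (by simpa [one_add_one_eq_two] using hσ)
      exact this.2.2
    exact this.differentiable (by norm_num)
  have h1 : HasFDerivAt (fun Y => deriv σ (g Y)) (deriv (deriv σ) (g X) • fderiv ℝ g X) X :=
    (hσ1 (g X)).hasDerivAt.comp_hasFDerivAt X (hgd X).hasFDerivAt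
  have h2 := h1.mul (diff_dir hg q X).hasFDerivAt
  rw [h]
  have h3 : fderiv ℝ (fun Y => deriv σ (g Y) * fderiv ℝ g Y q) X = _ := h2.fderiv
  rw [h3]
  simp
  ring

theorem norm_le_of_coord {x y : EuclideanSpace ℝ (Fin d)} (h : ∀ i, |x i| ≤ |y i|) :
    ‖x‖ ≤ ‖y‖ := by
  rw [EuclideanSpace.norm_eq, EuclideanSpace.norm_eq]
  apply Real.sqrt_le_sqrt
  apply Finset.sum_le_sum
  intro i _
  simp only [Real.norm_eq_abs]
  exact pow_le_pow_left₀ (abs_nonneg _) (h i) 2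

theorem act_fderiv_le {σ : ℝ → ℝ} (hσ : ContDiff ℝ 2 σ) (hσ' : ∀ x, |deriv σ x| ≤ 1)
    {f : E → EuclideanSpace ℝ (Fin d)} (hf : ContDiff ℝ 2 f) (X p : E) :
    ‖fderiv ℝ (fun Y => act σ (f Y)) X p‖ ≤ ‖fderiv ℝ f X p‖ := by
  apply norm_le_of_coord
  intro i
  have hfd : Differentiable ℝ f := hf.differentiable (by norm_num)
  rw [← fderiv_coord ((act_contDiff hσ hf).differentiable (by norm_num)), ← fderiv_coord hfd]
  have hg : Differentiable ℝ (fun Y => f Y i) := (contDiff_euclidean.1 hf i).differentiable (by norm_num)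
  have := scalar_fderiv hσ hg X p
  change |fderiv ℝ (fun Y => σ (f Y i)) X p| ≤ _
  rw [this, abs_mul]
  exact mul_le_of_le_one_left (abs_nonneg _) (hσ' _)

theorem act_DD_le {σ : ℝ → ℝ} (hσ : ContDiff ℝ 2 σ) (hσ' : ∀ x, |deriv σ x| ≤ 1)
    (hσ'' : ∀ x, |deriv (deriv σ) x| ≤ 1)
    {f : E → EuclideanSpace ℝ (Fin d)} (hf : ContDiff ℝ 2 f) (X p q : E) :
    ‖DD p q (fun Y => act σ (f Y)) X‖
      ≤ ‖fderiv ℝ f X p‖ * ‖fderiv ℝ f X q‖ + ‖DD p q f X‖ := by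
  have hfd : Differentiable ℝ f := hf.differentiable (by norm_num)
  set a := fderiv ℝ f X p
  set b := fderiv ℝ f X q
  set c := DD p q f X
  have key : DD p q (fun Y => act σ (f Y)) X =
      WithLp.toLp 2 (fun i => deriv (deriv σ) (f X i) * a i * b i)
        + WithLp.toLp 2 (fun i => deriv σ (f X i) * c i) := by
    ext i
    rw [← DD_coord (act_contDiff hσ hf)]
    have := scalar_DD hσ (contDiff_euclidean.1 hf i) X p q
    rw [fderiv_coord hfd, fderiv_coord hfd, DD_coord hf] at this
    exact this
  rw [key]
  refine (norm_add_le _ _).trans (add_le_add ?_ ?_)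
  · have : ‖a‖ * ‖b‖ = ‖(‖a‖ • b)‖ := by rw [norm_smul, norm_norm]
    rw [this]
    apply norm_le_of_coord
    intro i
    have h1 : |a i| ≤ ‖a‖ := by simpa using PiLp.norm_apply_le a i
    simp only [PiLp.smul_apply, smul_eq_mul, abs_mul, abs_norm]
    refine mul_le_mul_of_nonneg_right ?_ (abs_nonneg _)
    exact (mul_le_of_le_one_left (abs_nonneg _) (hσ'' _)).trans h1
  · apply norm_le_of_coord
    intro i
    simp only [abs_mul]
    exact mul_le_of_le_one_left (abs_nonneg _) (hσ' _)

end Calculus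

section Network

variable (σ : ℝ → ℝ) (𝒜 Z : Matrix (Fin n) (Fin n) ℝ)
    (Ω W : ℕ → EuclideanSpace ℝ (Fin d) →L[ℝ] EuclideanSpace ℝ (Fin d))
    (ψ : ℕ → EuclideanSpace ℝ (Fin d) × EuclideanSpace ℝ (Fin d) → EuclideanSpace ℝ (Fin d))

/-- every layer is the activation of a sum of linear maps dominated by `Z`. -/
def LayerBound : Prop :=
  ∀ t : ℕ, ∀ i : Fin n, ∃ T : Fin n → EuclideanSpace ℝ (Fin d) →L[ℝ] EuclideanSpace ℝ (Fin d),
    (∀ j, ‖T j‖ ≤ Z i j) ∧ ∀ x : Fin n → EuclideanSpace ℝ (Fin d),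
      Ω (t+1) (x i) + W (t+1) (∑ u : Fin n, 𝒜 i u • ψ (t+1) (x i, x u)) = ∑ j, T j (x j)

theorem layerBound_of (h𝒜 : ∀ i j, 0 ≤ 𝒜 i j) (ω w c₁ c₂ γ : ℝ) (hw : 0 < w)
    (hrow : ∀ i, ∑ j, 𝒜 i j ≤ γ)
    (hΩ : ∀ t, ‖Ω t‖ ≤ ω) (hW : ∀ t, ‖W t‖ ≤ w)
    (hψlin : ∀ t, IsLinearMap ℝ (ψ t))
    (hψ₁ : ∀ t x y, ‖fderiv ℝ (fun z => ψ t (z, y)) x‖ ≤ c₁)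
    (hψ₂ : ∀ t x y, ‖fderiv ℝ (fun z => ψ t (x, z)) y‖ ≤ c₂)
    (hw1 : w ≤ 1) (hcap : ω / w + c₁ * γ + c₂ ≤ 1)
    (hZ : ∀ i j, Z i j = (if i = j then 1 - c₂ else 0) + c₂ * 𝒜 i j) :
    LayerBound 𝒜 Z Ω W ψ := by
  intro t i
  let P : EuclideanSpace ℝ (Fin d) × EuclideanSpace ℝ (Fin d) →L[ℝ] EuclideanSpace ℝ (Fin d) :=
    LinearMap.toContinuousLinearMap (hψlin (t+1)).mk'
  have hP : ∀ x, ψ (t+1) x = P x := fun x => rfl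
  let L1 := P.comp (ContinuousLinearMap.inl ℝ _ _)
  let L2 := P.comp (ContinuousLinearMap.inr ℝ _ _)
  have hL : ∀ x y, ψ (t+1) (x, y) = L1 x + L2 y := by
    intro x y
    rw [hP]
    simp only [L1, L2, ContinuousLinearMap.comp_apply, ContinuousLinearMap.inl_apply,
      ContinuousLinearMap.inr_apply, ← map_add]
    simp
  have n1 : ‖L1‖ ≤ c₁ := by
    have h := hψ₁ (t+1) 0 0
    have e : (fun z => ψ (t+1) (z, 0)) = L1 := by
      funext z; rw [hL]; simp
    rw [e] at h
    simpa using h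
  have n2 : ‖L2‖ ≤ c₂ := by
    have h := hψ₂ (t+1) 0 0
    have e : (fun z => ψ (t+1) (0, z)) = L2 := by
      funext z; rw [hL]; simp
    rw [e] at h
    simpa using h
  have hc1 : 0 ≤ c₁ := (norm_nonneg _).trans n1
  have hc2 : 0 ≤ c₂ := (norm_nonneg _).trans n2
  have hs0 : 0 ≤ ∑ j, 𝒜 i j := Finset.sum_nonneg fun j _ => h𝒜 i j
  let B := Ω (t+1) + (∑ j, 𝒜 i j) • (W (t+1)).comp L1
  have hB : ‖B‖ ≤ 1 - c₂ := by
    have e1 : ‖B‖ ≤ ω + γ * (w * c₁) := by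
      refine (norm_add_le _ _).trans (add_le_add (hΩ _) ?_)
      rw [norm_smul, Real.norm_eq_abs, abs_of_nonneg hs0]
      refine mul_le_mul (hrow i) ?_ (norm_nonneg _) (hs0.trans (hrow i))
      exact ((W (t+1)).opNorm_comp_le L1).trans
        (mul_le_mul (hW _) n1 (norm_nonneg _) hw.le)
    have e2 : ω + γ * (w * c₁) = w * (ω / w + c₁ * γ) := by field_simp
    have e3 : w * (ω / w + c₁ * γ) ≤ 1 * (ω / w + c₁ * γ) := by
      refine mul_le_mul_of_nonneg_right hw1 ?_
      have : 0 ≤ ω := (norm_nonneg _).trans (hΩ 0)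
      have : 0 ≤ γ := hs0.trans (hrow i)
      positivity
    linarith
  have hC : ‖(W (t+1)).comp L2‖ ≤ c₂ := by
    refine ((W (t+1)).opNorm_comp_le L2).trans ?_
    calc ‖W (t+1)‖ * ‖L2‖ ≤ 1 * c₂ :=
          mul_le_mul ((hW _).trans hw1) n2 (norm_nonneg _) zero_le_one
      _ = c₂ := one_mul _
  refine ⟨fun j => (if i = j then B else 0) + 𝒜 i j • (W (t+1)).comp L2, ?_, ?_⟩
  · intro j
    rw [hZ]
    refine (norm_add_le _ _).trans (add_le_add ?_ ?_)
    · split_ifs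
      · exact hB
      · simp
    · rw [norm_smul, Real.norm_eq_abs, abs_of_nonneg (h𝒜 i j), mul_comm]
      exact mul_le_mul_of_nonneg_right hC (h𝒜 i j)
  · intro x
    have e : ∀ j, ((if i = j then B else 0) + 𝒜 i j • (W (t+1)).comp L2) (x j)
        = (if i = j then B (x j) else 0) + 𝒜 i j • W (t+1) (L2 (x j)) := by
      intro j
      split_ifs <;> simp
    simp only [e, Finset.sum_add_distrib, Finset.sum_ite_eq, Finset.mem_univ, if_true, hL, smul_add,
      map_add, map_sum, map_smul]
    simp only [B, add_apply, smul_apply,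
      ContinuousLinearMap.comp_apply, Finset.sum_smul]
    abel

variable {σ 𝒜 Z Ω W ψ}

theorem mpnn_contDiff (hσ : ContDiff ℝ 2 σ) (hL : LayerBound 𝒜 Z Ω W ψ) (t : ℕ) :
    ∀ i, ContDiff ℝ 2 (fun X => mpnn σ 𝒜 Ω W ψ t X i) := by
  induction t with
  | zero => intro i; simp only [mpnn]; exact contDiff_apply _ _ i
  | succ t ih =>
    intro i
    obtain ⟨T, -, hT⟩ := hL t i
    simp only [mpnn]
    simp only [hT]
    apply act_contDiff hσ
    exact ContDiff.sum fun j _ => (T j).contDiff.comp (ih j)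

theorem mpnn_pre_bound (hσ : ContDiff ℝ 2 σ) (hL : LayerBound 𝒜 Z Ω W ψ) (t : ℕ)
    (i : Fin n) :
    ∃ f : (Fin n → EuclideanSpace ℝ (Fin d)) → EuclideanSpace ℝ (Fin d),
      ContDiff ℝ 2 f ∧ (fun X => mpnn σ 𝒜 Ω W ψ (t+1) X i) = (fun X => act σ (f X)) ∧
      (∀ X p, ‖fderiv ℝ f X p‖ ≤ ∑ j, Z i j * ‖fderiv ℝ (fun X => mpnn σ 𝒜 Ω W ψ t X j) X p‖) ∧
      (∀ X p q, ‖DD p q f X‖ ≤ ∑ j, Z i j * ‖DD p q (fun X => mpnn σ 𝒜 Ω W ψ t X j) X‖) := by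
  obtain ⟨T, hTn, hT⟩ := hL t i
  have hc := mpnn_contDiff (n := n) (d := d) hσ hL t
  refine ⟨fun X => ∑ j, T j (mpnn σ 𝒜 Ω W ψ t X j),
    ContDiff.sum fun j _ => (T j).contDiff.comp (hc j), ?_, ?_, ?_⟩
  · funext X
    simp only [mpnn, hT]
  · intro X p
    rw [fderiv_sum_clm T (fun j X => mpnn σ 𝒜 Ω W ψ t X j)
      (fun j => (hc j).differentiable (by norm_num))]
    refine (norm_sum_le _ _).trans (Finset.sum_le_sum fun j _ => ?_)
    exact (T j).le_of_opNorm_le (hTn j) _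
  · intro X p q
    rw [DD_sum_clm T (fun j X => mpnn σ 𝒜 Ω W ψ t X j) hc]
    refine (norm_sum_le _ _).trans (Finset.sum_le_sum fun j _ => ?_)
    exact (T j).le_of_opNorm_le (hTn j) _

theorem fderiv_apply_dir (X : Fin n → EuclideanSpace ℝ (Fin d)) (i : Fin n) (p) :
    fderiv ℝ (fun X : Fin n → EuclideanSpace ℝ (Fin d) => X i) X p = p i := by
  have h : HasFDerivAt (fun X : Fin n → EuclideanSpace ℝ (Fin d) => X i)
    (ContinuousLinearMap.proj (R := ℝ) (φ := fun _ : Fin n => EuclideanSpace ℝ (Fin d)) i) X :=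
    hasFDerivAt_apply i X
  rw [h.fderiv]
  rfl

theorem mpnn_fderiv_pre (hσ : ContDiff ℝ 2 σ) (hσ' : ∀ x, |deriv σ x| ≤ 1)
    (hZ0 : ∀ i j, 0 ≤ Z i j)
    (hL : LayerBound 𝒜 Z Ω W ψ) (v : Fin n) (α : Fin d) (t : ℕ) :
    ∀ i X, ‖fderiv ℝ (fun X => mpnn σ 𝒜 Ω W ψ t X i) X (dir v α)‖ ≤ (Z ^ t) i v := by
  induction t with
  | zero =>
    intro i X
    simp only [mpnn, fderiv_apply_dir, dir, pow_zero, Matrix.one_apply]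
    by_cases h : i = v
    · subst h; simp
    · simp [h]
  | succ t ih =>
    intro i X
    obtain ⟨f, hf, he, h1, -⟩ := mpnn_pre_bound (n := n) (d := d) hσ hL t i
    rw [he]
    refine (act_fderiv_le hσ hσ' hf X _).trans ((h1 X _).trans ?_)
    rw [pow_succ', Matrix.mul_apply]
    exact Finset.sum_le_sum fun j _ => mul_le_mul_of_nonneg_left (ih j X) (hZ0 i j)

theorem mpnn_DD_step (hσ : ContDiff ℝ 2 σ) (hσ' : ∀ x, |deriv σ x| ≤ 1)
    (hσ'' : ∀ x, |deriv (deriv σ) x| ≤ 1)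
    (hZ0 : ∀ i j, 0 ≤ Z i j)
    (hL : LayerBound 𝒜 Z Ω W ψ) (v u : Fin n) (α β : Fin d) (t : ℕ) (i X) :
    ‖DD (dir v α) (dir u β) (fun X => mpnn σ 𝒜 Ω W ψ (t+1) X i) X‖ ≤
      (Z ^ (t+1)) i v * (Z ^ (t+1)) i u +
      ∑ j, Z i j * ‖DD (dir v α) (dir u β) (fun X => mpnn σ 𝒜 Ω W ψ t X j) X‖ := by
  obtain ⟨f, hf, he, h1, h2⟩ := mpnn_pre_bound (n := n) (d := d) hσ hL t i
  rw [he]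
  have hb : ∀ v (α : Fin d), ‖fderiv ℝ f X (dir v α)‖ ≤ (Z ^ (t+1)) i v := by
    intro v α
    refine (h1 X _).trans ?_
    rw [pow_succ', Matrix.mul_apply]
    exact Finset.sum_le_sum fun j _ => mul_le_mul_of_nonneg_left
      (mpnn_fderiv_pre (n := n) (d := d) hσ hσ' hZ0 hL v α t j X) (hZ0 i j)
  refine (act_DD_le hσ hσ' hσ'' hf X _ _).trans (add_le_add ?_ (h2 X _ _))
  exact mul_le_mul (hb v α) (hb u β) (norm_nonneg _) ((norm_nonneg _).trans (hb v α))

theorem mpnn_DD_weighted (hσ : ContDiff ℝ 2 σ) (hσ' : ∀ x, |deriv σ x| ≤ 1)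
    (hσ'' : ∀ x, |deriv (deriv σ) x| ≤ 1)
    (hZ0 : ∀ i j, 0 ≤ Z i j) (ρ : Fin n → ℝ) (hρ : ∀ i, 0 ≤ ρ i)
    (hρZ : ∀ j, ∑ i, ρ i * Z i j = ρ j)
    (hL : LayerBound 𝒜 Z Ω W ψ) (v u : Fin n) (α β : Fin d) (X) (t : ℕ)  :
    ∑ i, ρ i * ‖DD (dir v α) (dir u β) (fun X => mpnn σ 𝒜 Ω W ψ t X i) X‖ ≤
      ∑ s ∈ Finset.range t, ∑ i, ρ i * ((Z ^ (s+1)) i v * (Z ^ (s+1)) i u) := by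
  induction t with
  | zero =>
    have : ∀ i, DD (dir v α) (dir u β) (fun X => mpnn σ 𝒜 Ω W ψ 0 X i) X = 0 := by
      intro i
      simp only [DD, mpnn, fderiv_apply_dir]
      simp
    simp [this]
  | succ t ih =>
    rw [Finset.sum_range_succ]
    calc _ ≤ ∑ i, ρ i * ((Z ^ (t+1)) i v * (Z ^ (t+1)) i u +
              ∑ j, Z i j * ‖DD (dir v α) (dir u β) (fun X => mpnn σ 𝒜 Ω W ψ t X j) X‖) :=
            Finset.sum_le_sum fun i _ => mul_le_mul_of_nonneg_left
              (mpnn_DD_step hσ hσ' hσ'' hZ0 hL v u α β t i X) (hρ i)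
      _ = ∑ i, ρ i * ‖DD (dir v α) (dir u β) (fun X => mpnn σ 𝒜 Ω W ψ t X i) X‖ +
            ∑ i, ρ i * ((Z ^ (t+1)) i v * (Z ^ (t+1)) i u) := by
          simp only [mul_add, Finset.sum_add_distrib, Finset.mul_sum]
          rw [add_comm]
          congr 1
          rw [Finset.sum_comm]
          refine Finset.sum_congr rfl fun j _ => ?_
          rw [← hρZ j, Finset.sum_mul]
          exact Finset.sum_congr rfl fun i _ => by ring
      _ ≤ _ := by gcongr

theorem mix_le (hσ : ContDiff ℝ 2 σ) (hL : LayerBound 𝒜 Z Ω W ψ)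
    (θ : EuclideanSpace ℝ (Fin d)) (hθ : ‖θ‖ = 1) (m : ℕ) (v u : Fin n) (X) (α β : Fin d) :
    |mixEntry θ σ 𝒜 Ω W ψ m v u X α β| ≤
      ∑ i, ‖DD (dir v α) (dir u β) (fun X => mpnn σ 𝒜 Ω W ψ m X i) X‖ := by
  have he : (fun X => readout θ σ 𝒜 Ω W ψ m X) =
      fun X => ∑ i, (innerSL ℝ θ) (mpnn σ 𝒜 Ω W ψ m X i) := by
    funext X
    rw [← map_sum]
    simp only [readout, innerSL_apply_apply, PiLp.inner_apply]
    exact Finset.sum_congr rfl fun i _ => by simp [mul_comm]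
  have h1 : mixEntry θ σ 𝒜 Ω W ψ m v u X α β =
    DD (dir v α) (dir u β) (fun X => ∑ i, (innerSL ℝ θ) (mpnn σ 𝒜 Ω W ψ m X i)) X := by
    rw [← he]; rfl
  rw [h1, DD_sum_clm (fun _ => innerSL ℝ θ) (fun i X => mpnn σ 𝒜 Ω W ψ m X i)
    (mpnn_contDiff hσ hL m), ← Real.norm_eq_abs]
  refine (norm_sum_le _ _).trans (Finset.sum_le_sum fun j _ => ?_)
  refine ((innerSL ℝ θ).le_opNorm _).trans ?_
  rw [innerSL_apply_norm, hθ, one_mul]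

theorem mix_bound (hσ : ContDiff ℝ 2 σ) (hσ' : ∀ x, |deriv σ x| ≤ 1)
    (hσ'' : ∀ x, |deriv (deriv σ) x| ≤ 1)
    (hZ0 : ∀ i j, 0 ≤ Z i j) (hZs : ∀ i j, Z i j = Z j i) (ρ : Fin n → ℝ)
    (lo hi : ℝ) (hlo : 0 < lo) (hρlo : ∀ i, lo ≤ ρ i) (hρhi : ∀ i, ρ i ≤ hi)
    (hρZ : ∀ j, ∑ i, ρ i * Z i j = ρ j)
    (hL : LayerBound 𝒜 Z Ω W ψ) (v u : Fin n) (α β : Fin d) (X)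
    (θ : EuclideanSpace ℝ (Fin d)) (hθ : ‖θ‖ = 1) (m : ℕ) :
    |mixEntry θ σ 𝒜 Ω W ψ m v u X α β| ≤
      hi / lo * ∑ k ∈ Finset.range (2 * m), (Z ^ (k + 1)) v u := by
  have hpow0 : ∀ k i j, 0 ≤ (Z ^ k) i j := by
    intro k
    induction k with
    | zero => intro i j; simp only [pow_zero, Matrix.one_apply]; split_ifs <;> norm_num
    | succ k ih =>
      intro i j
      rw [pow_succ, Matrix.mul_apply]
      exact Finset.sum_nonneg fun l _ => mul_nonneg (ih _ _) (hZ0 _ _)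
  have hpows : ∀ k i j, (Z ^ k) i j = (Z ^ k) j i := by
    intro k i j
    have hs : Z.transpose = Z := by ext a b; exact hZs b a
    have : (Z ^ k).transpose = Z ^ k := by rw [Matrix.transpose_pow, hs]
    exact (congrFun (congrFun this i) j).symm
  have hhi : 0 < hi := hlo.trans_le ((hρlo v).trans (hρhi v))
  have hev : ∑ s ∈ Finset.range m, (Z ^ (2 * (s+1))) v u
      ≤ ∑ k ∈ Finset.range (2 * m), (Z ^ (k + 1)) v u := by
    induction m with
    | zero => simp
    | succ m ih =>
      rw [Finset.sum_range_succ, show 2 * (m + 1) = 2 * m + 1 + 1 by ring, Finset.sum_range_succ,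
        Finset.sum_range_succ]
      have := hpow0 (2 * m + 1) v u
      linarith
  have hw := mpnn_DD_weighted (n := n) (d := d) hσ hσ' hσ'' hZ0 ρ
    (fun i => hlo.le.trans (hρlo i)) hρZ hL v u α β X m
  have h1 := mix_le (n := n) (d := d) hσ hL θ hθ m v u X α β
  have h2 : lo * ∑ i, ‖DD (dir v α) (dir u β) (fun X => mpnn σ 𝒜 Ω W ψ m X i) X‖
      ≤ ∑ i, ρ i * ‖DD (dir v α) (dir u β) (fun X => mpnn σ 𝒜 Ω W ψ m X i) X‖ := by
    rw [Finset.mul_sum]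
    exact Finset.sum_le_sum fun i _ => mul_le_mul_of_nonneg_right (hρlo i) (norm_nonneg _)
  have h3 : ∑ s ∈ Finset.range m, ∑ i, ρ i * ((Z ^ (s+1)) i v * (Z ^ (s+1)) i u) ≤
      hi * ∑ s ∈ Finset.range m, (Z ^ (2 * (s+1))) v u := by
    rw [Finset.mul_sum]
    refine Finset.sum_le_sum fun s _ => ?_
    rw [two_mul, pow_add Z (s+1) (s+1), Matrix.mul_apply, Finset.mul_sum]
    refine Finset.sum_le_sum fun i _ => ?_
    rw [hpows (s+1) v i]
    exact mul_le_mul_of_nonneg_right (hρhi i) (mul_nonneg (hpow0 _ _ _) (hpow0 _ _ _))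
  rw [div_mul_eq_mul_div, le_div_iff₀ hlo]
  have h4 := mul_le_mul_of_nonneg_left hev hhi.le
  have h5 := mul_le_mul_of_nonneg_left h1 hlo.le
  linarith

end Network

section Spectral

theorem final_real {ι : Type*} (F : Finset ι) (x y lam : ι → ℝ) (a b c₂ l1 γ L K : ℝ) (m : ℕ)
    (ha : 0 < a) (hb : 0 < b) (hc : 0 < c₂) (hl1 : 0 < l1) (hl : ∀ i ∈ F, l1 ≤ lam i)
    (hx : ∑ i ∈ F, x i ^ 2 = 1 - a ^ 2) (hy : ∑ i ∈ F, y i ^ 2 = 1 - b ^ 2)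
    (hxy : ∑ i ∈ F, x i * y i = - (a * b))
    (hab : b / a ≤ γ) (hba : a / b ≤ γ) (hL0 : 0 ≤ L)
    (hL : ∀ i ∈ F, |(1 - c₂ * lam i) ^ (2 * m + 1)| ≤ L) (hcl : c₂ * l1 ≤ 1 + L)
    (hK : K ≤ 2 * m * (a * b) + ∑ i ∈ F, x i * y i *
      ((1 - c₂ * lam i - (1 - c₂ * lam i) ^ (2 * m + 1)) / (c₂ * lam i))) :
    (∑ i ∈ F, 1 / lam i * (x i / a - y i / b) ^ 2) / (4 * c₂)
      + 1 / (2 * (a * b)) * (K - (γ + L) / (c₂ * l1)) ≤ m := by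
  have hcl0 : 0 < c₂ * l1 := mul_pos hc hl1
  -- termwise bound
  have hterm : ∀ i ∈ F, x i * y i *
      ((1 - c₂ * lam i - (1 - c₂ * lam i) ^ (2 * m + 1)) / (c₂ * lam i))
      + (a * b) / (2 * c₂) * (1 / lam i * (x i / a - y i / b) ^ 2)
      ≤ - (x i * y i) + (L * ((x i ^ 2 + y i ^ 2) / 2)) / (c₂ * l1)
        + (x i ^ 2 * (b / a) + y i ^ 2 * (a / b)) / 2 / (c₂ * l1) := by
    intro i hi
    have hli : 0 < lam i := hl1.trans_le (hl i hi)
    have hcli : 0 < c₂ * lam i := mul_pos hc hli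
    set P := (1 - c₂ * lam i) ^ (2 * m + 1)
    have e : x i * y i * ((1 - c₂ * lam i - P) / (c₂ * lam i))
      + (a * b) / (2 * c₂) * (1 / lam i * (x i / a - y i / b) ^ 2)
      = - (x i * y i) + (- (x i * y i * P)) / (c₂ * lam i)
        + (x i ^ 2 * (b / a) + y i ^ 2 * (a / b)) / 2 / (c₂ * lam i) := by
      field_simp
      ring
    rw [e]
    have hle : c₂ * l1 ≤ c₂ * lam i := mul_le_mul_of_nonneg_left (hl i hi) hc.le
    have h1 : - (x i * y i * P) ≤ L * ((x i ^ 2 + y i ^ 2) / 2) := by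
      have h2 : |x i * y i| ≤ (x i ^ 2 + y i ^ 2) / 2 := by
        rw [abs_le]; constructor <;> nlinarith [sq_nonneg (x i - y i), sq_nonneg (x i + y i)]
      calc - (x i * y i * P) ≤ |x i * y i * P| := neg_le_abs _
        _ = |P| * |x i * y i| := by rw [abs_mul, mul_comm]
        _ ≤ _ := mul_le_mul (hL i hi) h2 (abs_nonneg _) hL0
    have h3 : (- (x i * y i * P)) / (c₂ * lam i) ≤ (L * ((x i ^ 2 + y i ^ 2) / 2)) / (c₂ * l1) :=
      (div_le_div_of_nonneg_right h1 hcli.le).trans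
        (div_le_div_of_nonneg_left (by positivity) hcl0 hle)
    have h4 : (x i ^ 2 * (b / a) + y i ^ 2 * (a / b)) / 2 / (c₂ * lam i)
      ≤ (x i ^ 2 * (b / a) + y i ^ 2 * (a / b)) / 2 / (c₂ * l1) :=
        div_le_div_of_nonneg_left (by positivity) hcl0 hle
    linarith
  have hsum := Finset.sum_le_sum hterm
  have eR : ∑ i ∈ F, (- (x i * y i) + (L * ((x i ^ 2 + y i ^ 2) / 2)) / (c₂ * l1)
        + (x i ^ 2 * (b / a) + y i ^ 2 * (a / b)) / 2 / (c₂ * l1))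
      = a * b + (L * ((1 - a ^ 2 + (1 - b ^ 2)) / 2)) / (c₂ * l1)
        + ((1 - a ^ 2) * (b / a) + (1 - b ^ 2) * (a / b)) / 2 / (c₂ * l1) := by
    rw [← hx, ← hy]
    simp only [Finset.sum_add_distrib, ← Finset.sum_div, ← Finset.mul_sum, ← Finset.sum_mul,
      Finset.sum_neg_distrib, hxy, neg_neg]
  rw [eR, Finset.sum_add_distrib, ← Finset.mul_sum] at hsum
  set T := ∑ i ∈ F, 1 / lam i * (x i / a - y i / b) ^ 2
  set R := ∑ i ∈ F, x i * y i *
      ((1 - c₂ * lam i - (1 - c₂ * lam i) ^ (2 * m + 1)) / (c₂ * lam i))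
  have hfin : a * b + (L * ((1 - a ^ 2 + (1 - b ^ 2)) / 2)) / (c₂ * l1)
        + ((1 - a ^ 2) * (b / a) + (1 - b ^ 2) * (a / b)) / 2 / (c₂ * l1)
      ≤ (γ + L) / (c₂ * l1) := by
    have e1 : (1 - a ^ 2) * (b / a) + (1 - b ^ 2) * (a / b) = b / a + a / b - 2 * (a * b) := by
      field_simp
      ring
    rw [e1, le_div_iff₀ hcl0, add_mul, add_mul, div_mul_cancel₀ _ hcl0.ne',
      div_mul_cancel₀ _ hcl0.ne']
    have h1 : (1 - a ^ 2 + (1 - b ^ 2)) / 2 ≤ 1 - a * b := by nlinarith [sq_nonneg (a - b)]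
    have h2 := mul_le_mul_of_nonneg_left h1 hL0
    have h3 := mul_le_mul_of_nonneg_left hcl (mul_pos ha hb).le
    nlinarith
  have hab0 : 0 < 2 * (a * b) := by positivity
  have e2 : T / (4 * c₂) + 1 / (2 * (a * b)) * (K - (γ + L) / (c₂ * l1))
      = (a * b / (2 * c₂) * T + (K - (γ + L) / (c₂ * l1))) / (2 * (a * b)) := by
    field_simp
    ring
  rw [e2, div_le_iff₀ hab0]
  linarith

variable (lam : Fin n → ℝ) (φ : Fin n → Fin n → ℝ)

theorem complete_of_orth
    (horth : ∀ k l, ∑ a, φ k a * φ l a = if k = l then (1 : ℝ) else 0) (a b : Fin n) :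
    ∑ l, φ l a * φ l b = if a = b then (1 : ℝ) else 0 := by
  have h : (Matrix.of φ) * (Matrix.of φ).transpose = 1 := by
    ext k l
    rw [Matrix.mul_apply, Matrix.one_apply]
    exact horth k l
  have h2 := mul_eq_one_comm.1 h
  have h3 := congrFun (congrFun h2 a) b
  rw [Matrix.mul_apply, Matrix.one_apply] at h3
  exact h3

theorem pow_spectral (Z : Matrix (Fin n) (Fin n) ℝ) (μ : Fin n → ℝ)
    (horth : ∀ k l, ∑ a, φ k a * φ l a = if k = l then (1 : ℝ) else 0)
    (heig : ∀ l, Z.mulVec (φ l) = μ l • φ l) (k : ℕ) (a b : Fin n) :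
    (Z ^ k) a b = ∑ l, μ l ^ k * (φ l a * φ l b) := by
  have hp : ∀ l, (Z ^ k).mulVec (φ l) = μ l ^ k • φ l := by
    intro l
    induction k with
    | zero => simp
    | succ k ih =>
      rw [pow_succ, ← Matrix.mulVec_mulVec, heig, Matrix.mulVec_smul, ih, smul_smul, pow_succ,
        mul_comm]
  have h1 : (Z ^ k) a b = ∑ c, (Z ^ k) a c * ∑ l, φ l c * φ l b := by
    simp [complete_of_orth φ horth]
  rw [h1]
  simp only [Finset.mul_sum]
  rw [Finset.sum_comm]
  refine Finset.sum_congr rfl fun l _ => ?_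
  have h2 := congrFun (hp l) a
  simp only [Matrix.mulVec, dotProduct, Pi.smul_apply, smul_eq_mul] at h2
  rw [← mul_assoc, ← h2, Finset.sum_mul]
  exact Finset.sum_congr rfl fun c _ => by ring

theorem pow_zero_of_dist (G : SimpleGraph (Fin n)) (hconn : G.Connected)
    (Z : Matrix (Fin n) (Fin n) ℝ) (hZ : ∀ i j, Z i j ≠ 0 → i = j ∨ G.Adj i j) (k : ℕ) :
    ∀ i j, (Z ^ k) i j ≠ 0 → G.dist i j ≤ k := by
  induction k with
  | zero =>
    intro i j h
    rw [pow_zero, Matrix.one_apply] at h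
    have : i = j := by by_contra h'; simp [h'] at h
    subst this
    simp
  | succ k ih =>
    intro i j h
    rw [pow_succ, Matrix.mul_apply] at h
    obtain ⟨l, -, hl⟩ := Finset.exists_ne_zero_of_sum_ne_zero h
    have h1 := ih i l (left_ne_zero_of_mul hl)
    have h2 : G.dist l j ≤ 1 := by
      rcases hZ l j (right_ne_zero_of_mul hl) with h | h
      · subst h; simp
      · exact (SimpleGraph.dist_eq_one_iff_adj.2 h).le
    have := hconn.dist_triangle (u := i) (v := l) (w := j)
    omega

theorem Asym_apply (G : SimpleGraph (Fin n)) [DecidableRel G.Adj] (i j : Fin n) :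
    Asym G i j = (Real.sqrt (G.degree i))⁻¹ * (if G.Adj i j then 1 else 0) *
      (Real.sqrt (G.degree j))⁻¹ := by
  rw [Asym, Matrix.mul_diagonal, Matrix.diagonal_mul, SimpleGraph.adjMatrix_apply]

end Spectral

set_option maxHeartbeats 2000000

/-- depth lower bound for `𝒜 = A_sym` with linear message functions
(`c⁽²⁾ = 0`). -/
theorem depth_lower_bound_sym_linear (hn : 1 < n)
    (G : SimpleGraph (Fin n)) [DecidableRel G.Adj] (hconn : G.Connected)
    (σ : ℝ → ℝ) (hσ : ContDiff ℝ 2 σ)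
    (hσ' : ∀ x, |deriv σ x| ≤ 1) (hσ'' : ∀ x, |deriv (deriv σ) x| ≤ 1)
    (Ω W : ℕ → EuclideanSpace ℝ (Fin d) →L[ℝ] EuclideanSpace ℝ (Fin d))
    (ω w : ℝ) (hw : 0 < w) (hΩ : ∀ t, ‖Ω t‖ ≤ ω) (hW : ∀ t, ‖W t‖ ≤ w)
    (ψ : ℕ → EuclideanSpace ℝ (Fin d) × EuclideanSpace ℝ (Fin d) → EuclideanSpace ℝ (Fin d))
    (hψlin : ∀ t, IsLinearMap ℝ (ψ t)) (c₁ c₂ : ℝ) (hc₂0 : 0 < c₂) (hc₂1 : c₂ ≤ 1)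
    (hψ₁ : ∀ t x y, ‖fderiv ℝ (fun z => ψ t (z, y)) x‖ ≤ c₁)
    (hψ₂ : ∀ t x y, ‖fderiv ℝ (fun z => ψ t (x, z)) y‖ ≤ c₂)
    (γ : ℝ) (hγ : γ = Real.sqrt ((G.maxDegree : ℝ) / (G.minDegree : ℝ)))
    (hw1 : w ≤ 1) (hcap : ω / w + c₁ * γ + c₂ ≤ 1)
    (lam : Fin n → ℝ) (φ : Fin n → Fin n → ℝ)
    (horth : ∀ k l, ∑ a, φ k a * φ l a = if k = l then (1 : ℝ) else 0)
    (heig : ∀ ℓ, (nLap G).mulVec (φ ℓ) = lam ℓ • φ ℓ)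
    (hmono : Monotone lam)
    (hlam0 : lam ⟨0, by omega⟩ = 0)
    (hlampos : ∀ ℓ : Fin n, (ℓ : ℕ) ≠ 0 → 0 < lam ℓ)
    (hlamlt : ∀ ℓ, lam ℓ < 2)
    (hφ0 : ∀ a, φ ⟨0, by omega⟩ a = Real.sqrt ((G.degree a : ℝ) / (2 * G.edgeFinset.card)))
    (Λ : ℝ)
    (hΛ : IsGreatest {x : ℝ | ∃ ℓ : Fin n, (ℓ : ℕ) ≠ 0 ∧ x = |1 - c₂ * lam ℓ|} Λ)
    (v u : Fin n) (hvu : v ≠ u) (r : ℕ) (hr : r = G.dist v u)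
    (θ : EuclideanSpace ℝ (Fin d)) (hθ : ‖θ‖ = 1)
    (m : ℕ) (M : ℝ) (hM : 0 < M)
    (X : Fin n → EuclideanSpace ℝ (Fin d)) (α β : Fin d)
    (hmix : M ≤ |OSQ.mixEntry θ σ (Asym G) Ω W ψ m v u X α β|) :
    (m : ℝ) ≥ commuteTime G lam φ v u / (4 * c₂)
        + (G.edgeFinset.card : ℝ) / Real.sqrt ((G.degree v : ℝ) * (G.degree u : ℝ)) *
            (M / γ - (γ + Λ ^ (r - 1)) / (c₂ * lam ⟨1, hn⟩)) := by
  have hn0 : 0 < n := by omega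
  have : Nontrivial (Fin n) := Fin.nontrivial_iff_two_le.2 hn
  have : Nonempty (Fin n) := ⟨v⟩
  set z : Fin n := ⟨0, by omega⟩ with hz
  -- basic degree facts
  have hmin : 0 < G.minDegree := hconn.preconnected.minDegree_pos_of_nontrivial
  have hE : 0 < (G.edgeFinset.card : ℝ) := by
    have h1 := G.sum_degrees_eq_twice_card_edges
    have h2 : 0 < ∑ a, G.degree a :=
      Finset.sum_pos (fun a _ => hmin.trans_le (G.minDegree_le_degree a)) Finset.univ_nonempty
    have h3 : 0 < G.edgeFinset.card := by omega
    exact_mod_cast h3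
  set Ec : ℝ := (G.edgeFinset.card : ℝ) with hEc
  set lo := Real.sqrt ((G.minDegree : ℝ) / (2 * Ec)) with hlo_def
  set hi := Real.sqrt ((G.maxDegree : ℝ) / (2 * Ec)) with hhi_def
  have hminR : (0 : ℝ) < G.minDegree := by exact_mod_cast hmin
  have hlo : 0 < lo := Real.sqrt_pos.2 (by positivity)
  have hρlo : ∀ i, lo ≤ φ z i := by
    intro i
    rw [hφ0]
    apply Real.sqrt_le_sqrt
    have : (G.minDegree : ℝ) ≤ G.degree i := by exact_mod_cast G.minDegree_le_degree i
    gcongr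
  have hρhi : ∀ i, φ z i ≤ hi := by
    intro i
    rw [hφ0]
    apply Real.sqrt_le_sqrt
    have : (G.degree i : ℝ) ≤ G.maxDegree := by exact_mod_cast G.degree_le_maxDegree i
    gcongr
  have hγ' : γ = hi / lo := by
    rw [hγ, hhi_def, hlo_def, ← Real.sqrt_div' _ (by positivity)]
    congr 1
    field_simp
  have hdeg : ∀ i, (0 : ℝ) < G.degree i := by
    intro i
    exact_mod_cast hmin.trans_le (G.minDegree_le_degree i)
  -- the matrices
  have hA0 : ∀ i j, 0 ≤ Asym G i j := by
    intro i j
    rw [Asym_apply]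
    split_ifs <;> positivity
  have hAs : ∀ i j, Asym G i j = Asym G j i := by
    intro i j
    rw [Asym_apply, Asym_apply]
    simp only [G.adj_comm i j]
    ring
  have hAdiag : ∀ i, Asym G i i = 0 := by
    intro i
    rw [Asym_apply]; simp
  have hZ : ∀ i j, Zmat c₂ G i j = (if i = j then 1 - c₂ else 0) + c₂ * Asym G i j := by
    intro i j
    simp only [Zmat, nLap, Matrix.sub_apply, Matrix.smul_apply, smul_eq_mul, Matrix.one_apply]
    split_ifs <;> ring
  have hZ0 : ∀ i j, 0 ≤ Zmat c₂ G i j := by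
    intro i j
    rw [hZ]
    have := mul_nonneg hc₂0.le (hA0 i j)
    split_ifs <;> linarith
  have hZs : ∀ i j, Zmat c₂ G i j = Zmat c₂ G j i := by
    intro i j
    rw [hZ, hZ, hAs i j]
    simp only [eq_comm]
  have hZeig : ∀ l, (Zmat c₂ G).mulVec (φ l) = (1 - c₂ * lam l) • φ l := by
    intro l
    rw [Zmat, Matrix.sub_mulVec, Matrix.smul_mulVec, heig, Matrix.one_mulVec, smul_smul,
      sub_smul, one_smul]
  have hρZ : ∀ j, ∑ i, φ z i * Zmat c₂ G i j = φ z j := by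
    intro j
    have h := congrFun (hZeig z) j
    rw [hlam0] at h
    simp only [Matrix.mulVec, dotProduct, Pi.smul_apply, smul_eq_mul, mul_zero, sub_zero,
      one_mul] at h
    rw [← h]
    refine Finset.sum_congr rfl fun i _ => ?_
    rw [hZs i j, mul_comm]
  have hrow : ∀ i, ∑ j, Asym G i j ≤ γ := by
    intro i
    have h := congrFun (heig z) i
    rw [hlam0, nLap, Matrix.sub_mulVec, Matrix.one_mulVec] at h
    simp only [Matrix.mulVec, dotProduct, Pi.smul_apply, Pi.sub_apply, smul_eq_mul,
      zero_mul] at h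
    rw [hγ', le_div_iff₀ hlo, Finset.sum_mul]
    calc ∑ j, Asym G i j * lo ≤ ∑ j, Asym G i j * φ z j :=
          Finset.sum_le_sum fun j _ => mul_le_mul_of_nonneg_left (hρlo j) (hA0 i j)
      _ = φ z i := by linarith
      _ ≤ hi := hρhi i
  have hLB : LayerBound (Asym G) (Zmat c₂ G) Ω W ψ :=
    layerBound_of (Asym G) (Zmat c₂ G) Ω W ψ hA0 ω w c₁ c₂ γ hw hrow hΩ hW hψlin hψ₁ hψ₂
      hw1 hcap hZ
  have hγ0 : 0 < γ := by
    rw [hγ']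
    exact div_pos (hlo.trans_le ((hρlo v).trans (hρhi v))) hlo
  have hmb := hmix.trans (mix_bound (Z := Zmat c₂ G) hσ hσ' hσ'' hZ0 hZs (φ z) lo hi hlo hρlo
    hρhi hρZ hLB v u α β X θ hθ m)
  rw [← hγ'] at hmb
  set a := φ z v with ha_def
  set b := φ z u with hb_def
  have ha : 0 < a := hlo.trans_le (hρlo v)
  have hb : 0 < b := hlo.trans_le (hρlo u)
  have hK : M / γ ≤ ∑ k ∈ Finset.range (2 * m), (Zmat c₂ G ^ (k + 1)) v u := by
    rw [div_le_iff₀ hγ0, mul_comm]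
    exact hmb
  -- distance considerations
  have hsupp : ∀ i j, Zmat c₂ G i j ≠ 0 → i = j ∨ G.Adj i j := by
    intro i j h
    by_contra hcon
    push Not at hcon
    apply h
    rw [hZ, Asym_apply]
    simp [hcon.1, hcon.2]
  have hr2m : r ≤ 2 * m := by
    by_contra hcon
    push Not at hcon
    have h0 : ∑ k ∈ Finset.range (2 * m), (Zmat c₂ G ^ (k + 1)) v u = 0 := by
      apply Finset.sum_eq_zero
      intro k hk
      by_contra hne
      have := pow_zero_of_dist G hconn _ hsupp (k+1) v u hne
      have := Finset.mem_range.1 hk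
      omega
    rw [h0] at hK
    have : 0 < M / γ := div_pos hM hγ0
    linarith
  have hcomp := complete_of_orth φ horth
  set F := Finset.univ.filter (fun l : Fin n => (l : ℕ) ≠ 0) with hF
  have hsplit : ∀ f : Fin n → ℝ, ∑ l, f l = f z + ∑ l ∈ F, f l := by
    intro f
    have hFe : F = Finset.univ.erase z := by
      ext l
      simp [hF, hz, Fin.ext_iff]
    rw [hFe, Finset.add_sum_erase _ _ (Finset.mem_univ z)]
  set l1 := lam ⟨1, hn⟩ with hl1_def
  have hl1 : 0 < l1 := hlampos _ (by simp)
  have hl : ∀ l ∈ F, l1 ≤ lam l := by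
    intro l hlF
    apply hmono
    rw [Fin.le_def]
    have := (Finset.mem_filter.1 hlF).2
    simp only
    omega
  have hsx : ∑ l ∈ F, φ l v ^ 2 = 1 - a ^ 2 := by
    have h := hcomp v v
    rw [hsplit, if_pos rfl] at h
    simp only [sq]
    linarith
  have hsy : ∑ l ∈ F, φ l u ^ 2 = 1 - b ^ 2 := by
    have h := hcomp u u
    rw [hsplit, if_pos rfl] at h
    simp only [sq]
    linarith
  have hsxy : ∑ l ∈ F, φ l v * φ l u = -(a * b) := by
    have h := hcomp v u
    rw [hsplit, if_neg hvu] at h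
    linarith
  have hΛmem : ∀ l ∈ F, |1 - c₂ * lam l| ≤ Λ := fun l hlF =>
    hΛ.2 ⟨l, (Finset.mem_filter.1 hlF).2, rfl⟩
  have hΛ1 : Λ ≤ 1 := by
    obtain ⟨l, hl0, rfl⟩ := hΛ.1
    have h1 := hlampos l hl0
    have h2 := hlamlt l
    rw [abs_le]
    constructor <;> nlinarith
  have hΛ0 : 0 ≤ Λ := by
    obtain ⟨l, hl0, rfl⟩ := hΛ.1
    exact abs_nonneg _
  have hr1 : 1 ≤ r := by
    rw [hr]
    exact hconn.pos_dist_of_ne hvu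
  have hL0 : 0 ≤ Λ ^ (r - 1) := pow_nonneg hΛ0 _
  have hLle : ∀ l ∈ F, |(1 - c₂ * lam l) ^ (2 * m + 1)| ≤ Λ ^ (r - 1) := by
    intro l hlF
    rw [abs_pow]
    exact (pow_le_pow_left₀ (abs_nonneg _) (hΛmem l hlF) _).trans
      (pow_le_pow_of_le_one hΛ0 hΛ1 (by omega))
  have hcl : c₂ * l1 ≤ 1 + Λ ^ (r - 1) := by
    rcases Nat.eq_or_lt_of_le hr1 with h1 | h1
    · rw [← h1]
      have : l1 < 2 := hlamlt _
      simp only [Nat.sub_self, pow_zero]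
      nlinarith
    · have hnadj : ¬ G.Adj v u := by
        intro hadj
        have := SimpleGraph.dist_eq_one_iff_adj.2 hadj
        omega
      have hAvu : Asym G v u = 0 := by rw [Asym_apply]; simp [hnadj]
      have hsp := fun i j => pow_spectral φ (nLap G) lam horth heig 1 i j
      simp only [pow_one] at hsp
      have hvv : ∑ l, lam l * (φ l v * φ l v) = 1 := by
        rw [← hsp]; simp [nLap, hAdiag]
      have huu : ∑ l, lam l * (φ l u * φ l u) = 1 := by
        rw [← hsp]; simp [nLap, hAdiag]
      have hvu0 : ∑ l, lam l * (φ l v * φ l u) = 0 := by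
        rw [← hsp]; simp [nLap, hAvu, hvu]
      have e1 : ∑ l, lam l * (b * φ l v - a * φ l u) ^ 2 = b ^ 2 + a ^ 2 := by
        have : ∑ l, lam l * (b * φ l v - a * φ l u) ^ 2
            = b ^ 2 * ∑ l, lam l * (φ l v * φ l v) + a ^ 2 * ∑ l, lam l * (φ l u * φ l u)
              - 2 * a * b * ∑ l, lam l * (φ l v * φ l u) := by
          simp only [Finset.mul_sum, ← Finset.sum_add_distrib, ← Finset.sum_sub_distrib]
          exact Finset.sum_congr rfl fun l _ => by ring
        rw [this, hvv, huu, hvu0]; ring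
      have e2 : ∑ l, (b * φ l v - a * φ l u) ^ 2 = b ^ 2 + a ^ 2 := by
        have : ∑ l, (b * φ l v - a * φ l u) ^ 2
            = b ^ 2 * ∑ l, (φ l v * φ l v) + a ^ 2 * ∑ l, (φ l u * φ l u)
              - 2 * a * b * ∑ l, (φ l v * φ l u) := by
          simp only [Finset.mul_sum, ← Finset.sum_add_distrib, ← Finset.sum_sub_distrib]
          exact Finset.sum_congr rfl fun l _ => by ring
        rw [this, hcomp, hcomp, hcomp, if_pos rfl, if_pos rfl, if_neg hvu]; ring
      have hz0 : b * φ z v - a * φ z u = 0 := by rw [← ha_def, ← hb_def]; ring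
      rw [hsplit, hz0] at e1 e2
      have e3 : l1 * ∑ l ∈ F, (b * φ l v - a * φ l u) ^ 2
          ≤ ∑ l ∈ F, lam l * (b * φ l v - a * φ l u) ^ 2 := by
        rw [Finset.mul_sum]
        exact Finset.sum_le_sum fun l hlF => mul_le_mul_of_nonneg_right (hl l hlF) (sq_nonneg _)
      have hpos : 0 < b ^ 2 + a ^ 2 := by positivity
      have e4 : ∑ l ∈ F, (b * φ l v - a * φ l u) ^ 2 = b ^ 2 + a ^ 2 := by linarith
      have e5 : ∑ l ∈ F, lam l * (b * φ l v - a * φ l u) ^ 2 = b ^ 2 + a ^ 2 := by linarith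
      rw [e4, e5] at e3
      have hl11 : l1 ≤ 1 := by
        by_contra hcon
        push Not at hcon
        have := mul_lt_mul_of_pos_right hcon hpos
        linarith
      have := mul_le_one₀ hc₂1 hl1.le hl11
      linarith
  have hab : b / a ≤ γ := by
    rw [hγ']
    exact div_le_div₀ (hlo.le.trans ((hρlo v).trans (hρhi v))) (hρhi u) hlo (hρlo v)
  have hba : a / b ≤ γ := by
    rw [hγ']
    exact div_le_div₀ (hlo.le.trans ((hρlo v).trans (hρhi v))) (hρhi v) hlo (hρlo u)
  have hKK : M / γ ≤ 2 * m * (a * b) + ∑ l ∈ F, φ l v * φ l u *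
      ((1 - c₂ * lam l - (1 - c₂ * lam l) ^ (2 * m + 1)) / (c₂ * lam l)) := by
    refine hK.trans (le_of_eq ?_)
    simp only [pow_spectral φ (Zmat c₂ G) (fun l => 1 - c₂ * lam l) horth hZeig]
    rw [Finset.sum_comm, hsplit, hlam0]
    congr 1
    · simp [ha_def, hb_def]
    · refine Finset.sum_congr rfl fun l hlF => ?_
      have hc0 : c₂ * lam l ≠ 0 := (mul_pos hc₂0 (hl1.trans_le (hl l hlF))).ne'
      rw [← Finset.sum_mul, mul_comm]
      congr 1
      rw [eq_div_iff hc0]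
      have hg := geom_sum_mul (1 - c₂ * lam l) (2 * m)
      simp only [pow_succ, ← Finset.sum_mul]
      linear_combination (-(1 - c₂ * lam l)) * hg
  have hfinal := final_real F (fun l => φ l v) (fun l => φ l u) lam a b c₂ l1 γ (Λ ^ (r - 1))
    (M / γ) m ha hb hc₂0 hl1 hl hsx hsy hsxy hab hba hL0 hLle hcl hKK
  have hs2 : 0 < Real.sqrt (2 * Ec) := Real.sqrt_pos.2 (by positivity)
  have hs2s : Real.sqrt (2 * Ec) ^ 2 = 2 * Ec := Real.sq_sqrt (by positivity)
  have hav : Real.sqrt (G.degree v) = Real.sqrt (2 * Ec) * a := by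
    rw [ha_def, hφ0, Real.sqrt_div' _ (by positivity)]
    field_simp
  have hbu : Real.sqrt (G.degree u) = Real.sqrt (2 * Ec) * b := by
    rw [hb_def, hφ0, Real.sqrt_div' _ (by positivity)]
    field_simp
  have hτ : commuteTime G lam φ v u = ∑ l ∈ F, 1 / lam l * (φ l v / a - φ l u / b) ^ 2 := by
    rw [commuteTime, Finset.mul_sum]
    refine Finset.sum_congr rfl fun l hlF => ?_
    have hl0 : lam l ≠ 0 := (hl1.trans_le (hl l hlF)).ne'
    rw [hav, hbu, ← hEc]
    generalize Real.sqrt (2 * Ec) = s at hs2 hs2s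
    rw [← hs2s]
    field_simp
  have hco : Ec / Real.sqrt ((G.degree v : ℝ) * (G.degree u : ℝ)) = 1 / (2 * (a * b)) := by
    rw [Real.sqrt_mul (hdeg v).le, hav, hbu]
    have : Real.sqrt (2 * Ec) * a * (Real.sqrt (2 * Ec) * b) = 2 * Ec * (a * b) := by
      linear_combination (a * b) * hs2s
    rw [this]
    field_simp
  rw [hτ, hco]
  exact hfinal
end OSQ
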